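/- arXiv:2301.03746 — 3 statements merged into one kernel-verified Lean document; each statement's English description precedes it below -/
import Mathlib

section
/- Let A be a real square block matrix A = [[A11, A12], [A21, A22]], where A11 is p×p, A22 is c×c and A22 is invertible. If the symmetric part of A is negative semidefinite, i.e. xᵀ(A + Aᵀ)x ≤ 0 for all vectors x, then the symmetric part of the Schur complement A11 − A12·A22⁻¹·A21 is negative semidefinite, i.e. zᵀ((A11 − A12·A22⁻¹·A21) + (A11 − A12·A22⁻¹·A21)ᵀ)z ≤ 0 for all z ∈ ℝᵖ. -/
open Matrix

/-- The quadratic form of `M + Mᵀ` is twice that of `M`. -/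
lemma dotProduct_add_transpose_mulVec_self {n R : Type*} [Fintype n] [CommSemiring R]
    (M : Matrix n n R) (x : n → R) :
    x ⬝ᵥ ((M + Mᵀ) *ᵥ x) = 2 * (x ⬝ᵥ (M *ᵥ x)) := by
  rw [add_mulVec, dotProduct_add, mulVec_transpose, dotProduct_comm x (x ᵥ* M),
    ← dotProduct_mulVec, two_mul]

/-- A block matrix maps `(z, -A22⁻¹ A21 z)` to `(S z, 0)`, where `S` is the Schur complement
of `A22`. -/
lemma fromBlocks_mulVec_elim_schur {m n R : Type*} [Fintype m] [Fintype n] [DecidableEq n]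
    [CommRing R] (A11 : Matrix m m R) (A12 : Matrix m n R) (A21 : Matrix n m R)
    (A22 : Matrix n n R) [Invertible A22] (z : m → R) :
    fromBlocks A11 A12 A21 A22 *ᵥ Sum.elim z (-((A22⁻¹ * A21) *ᵥ z)) =
      Sum.elim ((A11 - A12 * A22⁻¹ * A21) *ᵥ z) 0 := by
  rw [fromBlocks_mulVec, Sum.elim_comp_inl, Sum.elim_comp_inr]
  congr 1
  · rw [mulVec_neg, mulVec_mulVec, sub_mulVec, sub_eq_add_neg, Matrix.mul_assoc]
  · rw [mulVec_neg, mulVec_mulVec, mul_inv_cancel_left_of_invertible, add_neg_cancel]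

/-- Lemma 1 (Schur complement of a matrix with negative semidefinite symmetric
part has negative semidefinite symmetric part). -/
theorem schur_complement_neg_semidef_symm_part
    (p c : ℕ)
    (A11 : Matrix (Fin p) (Fin p) ℝ) (A12 : Matrix (Fin p) (Fin c) ℝ)
    (A21 : Matrix (Fin c) (Fin p) ℝ) (A22 : Matrix (Fin c) (Fin c) ℝ)
    (hA22 : Invertible A22)
    (hA : ∀ x : Fin p ⊕ Fin c → ℝ,
      x ⬝ᵥ ((Matrix.fromBlocks A11 A12 A21 A22 +
        (Matrix.fromBlocks A11 A12 A21 A22)ᵀ) *ᵥ x) ≤ 0) :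
    ∀ z : Fin p → ℝ,
      z ⬝ᵥ (((A11 - A12 * A22⁻¹ * A21) + (A11 - A12 * A22⁻¹ * A21)ᵀ) *ᵥ z) ≤ 0 := by
  intro z
  have h := hA (Sum.elim z (-((A22⁻¹ * A21) *ᵥ z)))
  rwa [dotProduct_add_transpose_mulVec_self, fromBlocks_mulVec_elim_schur,
    sumElim_dotProduct_sumElim, dotProduct_zero, add_zero,
    ← dotProduct_add_transpose_mulVec_self] at h
end

section
/- Let H : ℝⁿ → ℝ be differentiable, let F : ℝⁿ → (real n×n matrices) satisfy xᵀ(F(z) + F(z)ᵀ)x ≤ 0 for all x, z ∈ ℝⁿ, and let x : ℝ → ℝⁿ be differentiable with x′(t) = F(x(t)) · ∇H(x(t)) for all t ∈ ℝ, where ∇H denotes the gradient of H. Then the function t ↦ H(x(t)) is nonincreasing (antitone) on ℝ. -/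
open Matrix

/-- The quadratic form of a real matrix is nonpositive if that of `A + Aᵀ` is. -/
theorem dotProduct_mulVec_nonpos_of_symmetric_part {ι : Type*} [Fintype ι] {A : Matrix ι ι ℝ}
    (hA : ∀ w : ι → ℝ, w ⬝ᵥ ((A + Aᵀ) *ᵥ w) ≤ 0) (w : ι → ℝ) : w ⬝ᵥ (A *ᵥ w) ≤ 0 := by
  have h := hA w
  rw [add_mulVec, dotProduct_add, mulVec_transpose, dotProduct_comm w (w ᵥ* A),
    ← dotProduct_mulVec] at h
  linarith

/-- Energy decreases along trajectories of `x′ = F(x)·∇H(x)` when the symmetric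
part of `F(z)` is negative semidefinite for every `z`. -/
theorem hamiltonian_nonincreasing
    (n : ℕ)
    (H : EuclideanSpace ℝ (Fin n) → ℝ) (hH : Differentiable ℝ H)
    (F : EuclideanSpace ℝ (Fin n) → Matrix (Fin n) (Fin n) ℝ)
    (hF : ∀ (z : EuclideanSpace ℝ (Fin n)) (w : Fin n → ℝ),
      w ⬝ᵥ ((F z + (F z)ᵀ) *ᵥ w) ≤ 0)
    (x : ℝ → EuclideanSpace ℝ (Fin n)) (hx : Differentiable ℝ x)
    (hdyn : ∀ t : ℝ,
      deriv x t = (WithLp.equiv 2 (Fin n → ℝ)).symm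
        (F (x t) *ᵥ (WithLp.equiv 2 (Fin n → ℝ)) (gradient H (x t)))) :
    Antitone (fun t => H (x t)) := by
  have hderiv : ∀ t, HasDerivAt (fun t => H (x t)) (inner ℝ (gradient H (x t)) (deriv x t)) t := by
    intro t
    have h := (hH (x t)).hasGradientAt.hasFDerivAt.comp_hasDerivAt t (hx t).hasDerivAt
    simpa [Function.comp_def] using h
  refine antitone_of_deriv_nonpos (fun t => (hderiv t).differentiableAt) fun t => ?_
  rw [(hderiv t).deriv, hdyn t, EuclideanSpace.inner_eq_star_dotProduct]
  have h := dotProduct_mulVec_nonpos_of_symmetric_part (hF (x t))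
    ((WithLp.equiv 2 (Fin n → ℝ)) (gradient H (x t)))
  rw [dotProduct_comm] at h
  simpa using h
end

section
/- Let H : ℝⁿ → ℝ be differentiable, F : ℝⁿ → (real n×n matrices) satisfy xᵀ(F(z) + F(z)ᵀ)x ≤ 0 for all x, z ∈ ℝⁿ, and G be a real n×m matrix. Let u : ℝ → ℝᵐ and let x : ℝ → ℝⁿ be differentiable with x′(t) = F(x(t))·∇H(x(t)) + G·u(t) for all t, and define the output y(t) = Gᵀ·∇H(x(t)). Then for every t, the derivative of t ↦ H(x(t)) satisfies (H ∘ x)′(t) ≤ ⟪y(t), u(t)⟫ (the passivity inequality). -/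
open Matrix

theorem Matrix.dotProduct_mulVec_nonpos_of_add_transpose {n : Type*} [Fintype n]
    {A : Matrix n n ℝ} {w : n → ℝ} (h : w ⬝ᵥ ((A + Aᵀ) *ᵥ w) ≤ 0) : w ⬝ᵥ (A *ᵥ w) ≤ 0 := by
  have hA : w ⬝ᵥ (Aᵀ *ᵥ w) = w ⬝ᵥ (A *ᵥ w) := by
    rw [mulVec_transpose, dotProduct_comm, dotProduct_mulVec]
  rw [add_mulVec, dotProduct_add, hA] at h
  linarith

theorem DifferentiableAt.deriv_comp_eq_inner_gradient {E : Type*} [NormedAddCommGroup E]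
    [InnerProductSpace ℝ E] [CompleteSpace E] {H : E → ℝ} {x : ℝ → E} {t : ℝ}
    (hH : DifferentiableAt ℝ H (x t)) (hx : DifferentiableAt ℝ x t) :
    deriv (fun s => H (x s)) t = Inner.inner ℝ (gradient H (x t)) (deriv x t) := by
  have h := hH.hasGradientAt.hasFDerivAt.comp_hasDerivAt t hx.hasDerivAt
  simpa [Function.comp_def] using h.deriv

/-- Passivity inequality: along trajectories of
`x′ = F(x)·∇H(x) + G·u` with output `y = Gᵀ·∇H(x)`, the derivative of the
Hamiltonian satisfies `(H ∘ x)′(t) ≤ ⟪y(t), u(t)⟫`. -/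
theorem passivity_inequality
    (n m : ℕ)
    (H : EuclideanSpace ℝ (Fin n) → ℝ) (hH : Differentiable ℝ H)
    (F : EuclideanSpace ℝ (Fin n) → Matrix (Fin n) (Fin n) ℝ)
    (hF : ∀ (z : EuclideanSpace ℝ (Fin n)) (w : Fin n → ℝ),
      w ⬝ᵥ ((F z + (F z)ᵀ) *ᵥ w) ≤ 0)
    (G : Matrix (Fin n) (Fin m) ℝ)
    (u : ℝ → Fin m → ℝ)
    (x : ℝ → EuclideanSpace ℝ (Fin n)) (hx : Differentiable ℝ x)
    (hdyn : ∀ t : ℝ,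
      deriv x t = (WithLp.equiv 2 (Fin n → ℝ)).symm
        (F (x t) *ᵥ (WithLp.equiv 2 (Fin n → ℝ)) (gradient H (x t))
          + G *ᵥ u t)) :
    ∀ t : ℝ,
      deriv (fun s => H (x s)) t ≤
        (Gᵀ *ᵥ (WithLp.equiv 2 (Fin n → ℝ)) (gradient H (x t))) ⬝ᵥ u t := by
  intro t
  rw [(hH (x t)).deriv_comp_eq_inner_gradient (hx t), hdyn t,
    EuclideanSpace.inner_eq_star_dotProduct, star_trivial, dotProduct_comm]
  simp only [WithLp.equiv_apply, WithLp.equiv_symm_apply, dotProduct_add]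
  rw [dotProduct_mulVec _ G, mulVec_transpose]
  linarith [dotProduct_mulVec_nonpos_of_add_transpose (hF (x t) (gradient H (x t)).ofLp)]
end
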